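/- Assume the Open Colouring Axiom (OCA). If φ : ℳ → P(ℕ)/fin is a Boolean-algebra embedding, then there exist an infinite set A ⊆ ℕ and a lifting Φ of φ such that: the sets Φ(n,∅) for n ∈ A are pairwise disjoint; for every n ∈ A and s ∈ 2^{<ω}, Φ(n,s) is the disjoint union of Φ(n,s⌢0) and Φ(n,s⌢1); and Φ(O) =* Φ[O] for every f ∈ ω^ω and every O ⊆ B_{f,A} = {(n,s) : n ∈ A, s ∈ 2^{f(n)}}. -/

import Mathlib

open Set MeasureTheory
open scoped ENNReal

namespace Paper

/-- The Open Colouring Axiom: for every separable metrizable space `X` and every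
partition `[X]² = K₀ ∪ K₁` of the unordered pairs with `K₀` open (coded here as a
symmetric open set `K ⊆ X × X` off the diagonal), either there is an uncountable
`K₀`-homogeneous set, or `X` is a countable union of `K₁`-homogeneous sets. -/
def OCA : Prop :=
  ∀ (X : Type) [MetricSpace X] [TopologicalSpace.SeparableSpace X],
    ∀ K : Set (X × X), IsOpen K → (∀ a b : X, (a, b) ∈ K → (b, a) ∈ K) →
      (∀ a : X, (a, a) ∉ K) →
      (∃ Y : Set X, ¬Y.Countable ∧ ∀ a ∈ Y, ∀ b ∈ Y, a ≠ b → (a, b) ∈ K) ∨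
      (∃ Y : ℕ → Set X, (⋃ n, Y n) = Set.univ ∧
        ∀ (n : ℕ), ∀ a ∈ Y n, ∀ b ∈ Y n, a ≠ b → (a, b) ∉ K)

/-- `X` and `Y` agree modulo a finite set. -/
def AlmostEq {α : Type} (X Y : Set α) : Prop := (symmDiff X Y).Finite

/-- the "equal mod finite" setoid on `Set α` -/
def finSetoid (α : Type) : Setoid (Set α) where
  r X Y := (symmDiff X Y).Finite
  iseqv := by
    constructor
    · intro X; simp
    · intro X Y h; rwa [symmDiff_comm]
    · intro X Y Z h1 h2
      exact (h1.union h2).subset (symmDiff_triangle X Y Z)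

/-- the quotient Boolean algebra `P(α)/fin` -/
def PFin (α : Type) : Type := Quotient (finSetoid α)

/-- the class of `X` in `P(α)/fin` -/
def PFin.mk {α : Type} (X : Set α) : PFin α := Quotient.mk (finSetoid α) X

/-- join in `P(α)/fin` -/
def PFin.sup {α : Type} : PFin α → PFin α → PFin α :=
  Quotient.lift₂ (fun X Y => PFin.mk (X ∪ Y))
    (by
      intro X Y X' Y' hX hY
      refine Quotient.sound ?_
      have hX' : (symmDiff X X').Finite := hX
      have hY' : (symmDiff Y Y').Finite := hY
      show (symmDiff (X ∪ Y) (X' ∪ Y')).Finite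
      refine (hX'.union hY').subset ?_
      intro x hx
      simp only [Set.mem_symmDiff, Set.mem_union] at hx ⊢
      tauto)

/-- meet in `P(α)/fin` -/
def PFin.inf {α : Type} : PFin α → PFin α → PFin α :=
  Quotient.lift₂ (fun X Y => PFin.mk (X ∩ Y))
    (by
      intro X Y X' Y' hX hY
      refine Quotient.sound ?_
      have hX' : (symmDiff X X').Finite := hX
      have hY' : (symmDiff Y Y').Finite := hY
      show (symmDiff (X ∩ Y) (X' ∩ Y')).Finite
      refine (hX'.union hY').subset ?_
      intro x hx
      simp only [Set.mem_symmDiff, Set.mem_inter_iff, Set.mem_union] at hx ⊢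
      tauto)

/-- complement in `P(α)/fin` -/
def PFin.compl {α : Type} : PFin α → PFin α :=
  Quotient.lift (fun X => PFin.mk Xᶜ)
    (by
      intro X Y h
      refine Quotient.sound ?_
      have h' : (symmDiff X Y).Finite := h
      show (symmDiff Xᶜ Yᶜ).Finite
      have e : symmDiff Xᶜ Yᶜ = symmDiff X Y := by
        ext x; simp only [Set.mem_symmDiff, Set.mem_compl_iff]; tauto
      rw [e]; exact h')

/-- bottom of `P(α)/fin` -/
def PFin.bot {α : Type} : PFin α := PFin.mk (∅ : Set α)

/-- top of `P(α)/fin` -/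
def PFin.top {α : Type} : PFin α := PFin.mk (Set.univ : Set α)

/-- the Cantor set `2^ω` -/
abbrev Cant : Type := ℕ → Bool

/-- the space `C = ω × 2^ω` -/
abbrev CSp : Type := ℕ × Cant

/-- the cylinder set `[s] = {x : s ⊂ x}` determined by a finite binary sequence -/
def cyl (s : List Bool) : Set Cant := {x | ∀ i : Fin s.length, x i.1 = s.get i}

/-- the basic clopen set `{n} × [s]` of `C` -/
def basic (n : ℕ) (s : List Bool) : Set CSp := {n} ×ˢ cyl s

lemma measurableSet_cyl (s : List Bool) : MeasurableSet (cyl s) := by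
  have h : cyl s = ⋂ i : Fin s.length, (fun x : Cant => x i.1) ⁻¹' {s.get i} := by
    ext x; simp [cyl]
  rw [h]
  exact MeasurableSet.iInter fun i => (measurable_pi_apply i.1) (measurableSet_singleton _)

lemma measurableSet_basic (n : ℕ) (s : List Bool) : MeasurableSet (basic n s) :=
  (measurableSet_singleton n).prod (measurableSet_cyl s)

/-- a measure on `C` is the right one when it gives each basic set `{n} × [s]`
measure `2^{-|s|}` (this determines the measure on all Borel sets). -/
def IsMeasureOK (μ : Measure CSp) : Prop :=
  ∀ (n : ℕ) (s : List Bool), μ (basic n s) = (2 : ℝ≥0∞)⁻¹ ^ s.length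

/-- Borel subsets of `C` -/
abbrev BSet : Type := {A : Set CSp // MeasurableSet A}

/-- the "equal modulo a null set" setoid on Borel sets of `C` -/
def measSetoid (μ : Measure CSp) : Setoid BSet where
  r A B := μ (symmDiff (A : Set CSp) (B : Set CSp)) = 0
  iseqv := by
    constructor
    · intro A; simp
    · intro A B h; rwa [symmDiff_comm]
    · intro A B C h1 h2
      exact measure_mono_null (symmDiff_triangle (A : Set CSp) (B : Set CSp) (C : Set CSp))
        (measure_union_null h1 h2)

/-- the measure algebra `ℳ = Bor(C)/𝒩` -/
def MAlg (μ : Measure CSp) : Type := Quotient (measSetoid μ)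

/-- the class of a Borel set in the measure algebra -/
def MAlg.mk (μ : Measure CSp) (A : BSet) : MAlg μ := Quotient.mk (measSetoid μ) A

variable {μ : Measure CSp}

/-- join in the measure algebra -/
def MAlg.sup : MAlg μ → MAlg μ → MAlg μ :=
  Quotient.lift₂ (fun A B : BSet => MAlg.mk μ ⟨(A : Set CSp) ∪ (B : Set CSp), A.2.union B.2⟩)
    (by
      intro A B A' B' hA hB
      refine Quotient.sound ?_
      have hA' : μ (symmDiff (A : Set CSp) (A' : Set CSp)) = 0 := hA
      have hB' : μ (symmDiff (B : Set CSp) (B' : Set CSp)) = 0 := hB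
      show μ (symmDiff ((A : Set CSp) ∪ (B : Set CSp)) ((A' : Set CSp) ∪ (B' : Set CSp))) = 0
      refine measure_mono_null ?_ (measure_union_null hA' hB')
      intro x hx
      simp only [Set.mem_symmDiff, Set.mem_union] at hx ⊢
      tauto)

/-- meet in the measure algebra -/
def MAlg.inf : MAlg μ → MAlg μ → MAlg μ :=
  Quotient.lift₂ (fun A B : BSet => MAlg.mk μ ⟨(A : Set CSp) ∩ (B : Set CSp), A.2.inter B.2⟩)
    (by
      intro A B A' B' hA hB
      refine Quotient.sound ?_
      have hA' : μ (symmDiff (A : Set CSp) (A' : Set CSp)) = 0 := hA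
      have hB' : μ (symmDiff (B : Set CSp) (B' : Set CSp)) = 0 := hB
      show μ (symmDiff ((A : Set CSp) ∩ (B : Set CSp)) ((A' : Set CSp) ∩ (B' : Set CSp))) = 0
      refine measure_mono_null ?_ (measure_union_null hA' hB')
      intro x hx
      simp only [Set.mem_symmDiff, Set.mem_inter_iff, Set.mem_union] at hx ⊢
      tauto)

/-- complement in the measure algebra -/
def MAlg.compl : MAlg μ → MAlg μ :=
  Quotient.lift (fun A : BSet => MAlg.mk μ ⟨(A : Set CSp)ᶜ, A.2.compl⟩)
    (by
      intro A B h
      refine Quotient.sound ?_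
      have h' : μ (symmDiff (A : Set CSp) (B : Set CSp)) = 0 := h
      show μ (symmDiff (A : Set CSp)ᶜ (B : Set CSp)ᶜ) = 0
      have e : symmDiff (A : Set CSp)ᶜ (B : Set CSp)ᶜ = symmDiff (A : Set CSp) (B : Set CSp) := by
        ext x; simp only [Set.mem_symmDiff, Set.mem_compl_iff]; tauto
      rw [e]; exact h')

/-- bottom of the measure algebra -/
def MAlg.bot : MAlg μ := MAlg.mk μ ⟨∅, MeasurableSet.empty⟩

/-- top of the measure algebra -/
def MAlg.top : MAlg μ := MAlg.mk μ ⟨Set.univ, MeasurableSet.univ⟩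

/-- `φ : ℳ → P(ℕ)/fin` is a Boolean-algebra embedding -/
structure IsEmbedding (μ : Measure CSp) (φ : MAlg μ → PFin ℕ) : Prop where
  injective : Function.Injective φ
  map_sup : ∀ a b, φ (MAlg.sup a b) = PFin.sup (φ a) (φ b)
  map_inf : ∀ a b, φ (MAlg.inf a b) = PFin.inf (φ a) (φ b)
  map_compl : ∀ a, φ (MAlg.compl a) = PFin.compl (φ a)
  map_bot : φ MAlg.bot = PFin.bot
  map_top : φ MAlg.top = PFin.top

/-- the open subset of `C` coded by a set `O` of pairs `(n,s)` -/
def openSet (O : Set (ℕ × List Bool)) : Set CSp := ⋃ p ∈ O, basic p.1 p.2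

lemma measurableSet_openSet (O : Set (ℕ × List Bool)) : MeasurableSet (openSet O) :=
  MeasurableSet.biUnion O.to_countable fun p _ => measurableSet_basic p.1 p.2

/-- the element of the measure algebra coded by `O` -/
def classOf (μ : Measure CSp) (O : Set (ℕ × List Bool)) : MAlg μ :=
  MAlg.mk μ ⟨openSet O, measurableSet_openSet O⟩

/-- `Φ` is a lifting of `φ : ℳ → P(ℕ)/fin`: it chooses a representative of `φ a` for every `a` -/
def IsLifting {μ : Measure CSp} (φ : MAlg μ → PFin ℕ) (Φ : MAlg μ → Set ℕ) : Prop :=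
  ∀ a, PFin.mk (Φ a) = φ a

/-- `Φ(O)`: the value of `Φ` at the class of the open set coded by `O` -/
def PhiSet {μ : Measure CSp} (Φ : MAlg μ → Set ℕ) (O : Set (ℕ × List Bool)) : Set ℕ :=
  Φ (classOf μ O)

/-- `Φ(n,s)` -/
def PhiPt {μ : Measure CSp} (Φ : MAlg μ → Set ℕ) (n : ℕ) (s : List Bool) : Set ℕ :=
  Φ (classOf μ {(n, s)})

/-- `Φ[O] = ⋃ {Φ(n,s) : (n,s) ∈ O}` -/
def PhiUnion {μ : Measure CSp} (Φ : MAlg μ → Set ℕ) (O : Set (ℕ × List Bool)) : Set ℕ :=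
  ⋃ p ∈ O, PhiPt Φ p.1 p.2

/-- the layer `B_f = {(n,s) : s ∈ 2^{f(n)}}` -/
def Bf (f : ℕ → ℕ) : Set (ℕ × List Bool) := {p | p.2.length = f p.1}

/-- the layer `B_{f,A} = {(n,s) : n ∈ A, s ∈ 2^{f(n)}}` -/
def BfA (f : ℕ → ℕ) (A : Set ℕ) : Set (ℕ × List Bool) := {p | p.1 ∈ A ∧ p.2.length = f p.1}

open Filter Topology

/-- agreement of two sequences below `k` -/
def Ag {S : Type} (k : ℕ) (b c : ℕ → S) : Prop := ∀ i < k, b i = c i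

/-- initial segment of a sequence -/
def nd {S : Type} (x : ℕ → S) (i : ℕ) : List S := (List.range i).map x

lemma nd_len {S : Type} (x : ℕ → S) (i : ℕ) : (nd x i).length = i := by simp [nd]

lemma nd_eq {S : Type} {x y : ℕ → S} {i : ℕ} : nd x i = nd y i ↔ Ag i x y := by
  simp [nd, Ag]

lemma nd_eq_len {S : Type} {x y : ℕ → S} {i j : ℕ} (h : nd x i = nd y j) : i = j := by
  have := congrArg List.length h
  simpa [nd_len] using this

lemma Ag.symm {S : Type} {k : ℕ} {b c : ℕ → S} (h : Ag k b c) : Ag k c b :=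
  fun i hi => (h i hi).symm

lemma Ag.trans {S : Type} {k : ℕ} {b c d : ℕ → S} (h : Ag k b c) (h' : Ag k c d) : Ag k b d :=
  fun i hi => (h i hi).trans (h' i hi)

lemma Ag.mono {S : Type} {k l : ℕ} {b c : ℕ → S} (h : Ag k b c) (hl : l ≤ k) : Ag l b c :=
  fun i hi => h i (lt_of_lt_of_le hi hl)

lemma Ag.refl {S : Type} (k : ℕ) (b : ℕ → S) : Ag k b b := fun _ _ => rfl

section top
variable {S : Type} [TopologicalSpace S] [DiscreteTopology S]

lemma isOpen_ag {Y : Type} [TopologicalSpace Y] {f g : Y → ℕ → S} (hf : Continuous f)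
    (hg : Continuous g) (d : ℕ) : IsOpen {y | Ag d (f y) (g y)} := by
  have : {y | Ag d (f y) (g y)} = ⋂ i ∈ Set.Iio d, {y | f y i = g y i} := by
    ext y; simp [Ag]
  rw [this]
  refine (Set.finite_Iio d).isOpen_biInter fun i _ => ?_
  have h : Continuous fun y => (f y i, g y i) :=
    ((continuous_apply i).comp hf).prodMk ((continuous_apply i).comp hg)
  exact (isOpen_discrete {p : S × S | p.1 = p.2}).preimage h

lemma isOpen_cyl (b : ℕ → S) (k : ℕ) : IsOpen {c | Ag k c b} :=
  isOpen_ag continuous_id continuous_const k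

lemma exists_cyl {U : Set (ℕ → S)} (hU : IsOpen U) {b : ℕ → S} (hb : b ∈ U) :
    ∃ k, ∀ c, Ag k c b → c ∈ U := by
  obtain ⟨v, ⟨x, n, rfl⟩, hbv, hv⟩ :=
    (PiNat.isTopologicalBasis_cylinders (fun _ : ℕ => S)).exists_subset_of_mem_open hb hU
  refine ⟨n, fun c hc => hv ?_⟩
  rw [PiNat.mem_cylinder_iff] at hbv ⊢
  intro i hi
  rw [hc i hi, hbv i hi]

lemma somewhere_dense {A : Set (ℕ → S)} (h : ¬ IsNowhereDense A) :
    ∃ b k, ∀ c, Ag k c b → ∀ l, ∃ a ∈ A, Ag l a c := by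
  obtain ⟨b, hb⟩ := Set.nonempty_iff_ne_empty.2 h
  obtain ⟨k, hk⟩ := exists_cyl isOpen_interior hb
  refine ⟨b, k, fun c hc l => ?_⟩
  have := interior_subset (hk c hc)
  obtain ⟨a, ha, ha'⟩ := mem_closure_iff.1 this _ (isOpen_cyl c l) (Ag.refl l c)
  exact ⟨a, ha', ha⟩

end top

/-- the graph of the selector `b` along the branch `x` -/
def Gr {S : Type} (x : ℕ → Bool) (b : ℕ → S) : Set (List Bool × S) :=
  {p | ∃ i, p = (nd x i, b i)}

open Classical in
/-- characteristic function -/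
noncomputable def chi (A : Set ℕ) : ℕ → Bool := fun j => decide (j ∈ A)

lemma chi_iff {A B : Set ℕ} {i : ℕ} : chi A i = chi B i ↔ (i ∈ A ↔ i ∈ B) := by
  simp [chi]

theorem oca_lemma1 (oca : OCA) {S : Type} [TopologicalSpace S] [DiscreteTopology S] [Countable S]
    (F : Set (List Bool × S) → Set ℕ) (H : Set (List Bool) → Set ℕ)
    (hFH : ∀ O E, ∀ᶠ j in atTop, (j ∈ F (O ∩ {p | p.1 ∈ E}) ↔ j ∈ F O ∧ j ∈ H E)) :
    ∃ X : ℕ → Set ((ℕ → Bool) × (ℕ → S)), (∀ p, ∃ N, p ∈ X N) ∧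
      ∀ N x b y c, (x, b) ∈ X N → (y, c) ∈ X N → ∀ d, x d ≠ y d → Ag d x y → Ag (d+1) b c →
        ∀ j, (j ∈ F (Gr x b) ∧ j ∈ H (range (nd y))) ↔ (j ∈ F (Gr y c) ∧ j ∈ H (range (nd x))) := by
  let ι : (ℕ → Bool) × (ℕ → S) → (ℕ → Bool) × (ℕ → S) × (ℕ → Bool) × (ℕ → Bool) :=
    fun p => (p.1, p.2, chi (F (Gr p.1 p.2)), chi (H (range (nd p.1))))
  let X := range ι
  let C : (d j : ℕ) → Set (X × X) := fun d j => {pq | pq.1.1.1 d ≠ pq.2.1.1 d ∧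
    Ag d pq.1.1.1 pq.2.1.1 ∧ Ag (d+1) pq.1.1.2.1 pq.2.1.2.1 ∧
    (pq.1.1.2.2.1 j && pq.2.1.2.2.2 j) ≠ (pq.2.1.2.2.1 j && pq.1.1.2.2.2 j)}
  let K : Set (X × X) := ⋃ d, ⋃ j, C d j
  letI : MetricSpace X := TopologicalSpace.metrizableSpaceMetric X
  have hK : IsOpen K := by
    refine isOpen_iUnion fun d => isOpen_iUnion fun j => ?_
    refine IsOpen.and ?_ (IsOpen.and ?_ (IsOpen.and ?_ ?_))
    · have h : Continuous fun pq : X × X => (pq.1.1.1 d, pq.2.1.1 d) := by fun_prop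
      exact (isOpen_discrete {p : Bool × Bool | p.1 ≠ p.2}).preimage h
    · exact isOpen_ag (by fun_prop) (by fun_prop) d
    · exact isOpen_ag (by fun_prop) (by fun_prop) (d+1)
    · have h : Continuous fun pq : X × X =>
          ((pq.1.1.2.2.1 j, pq.2.1.2.2.2 j), (pq.2.1.2.2.1 j, pq.1.1.2.2.2 j)) := by fun_prop
      exact (isOpen_discrete {p : (Bool × Bool) × (Bool × Bool) |
        (p.1.1 && p.1.2) ≠ (p.2.1 && p.2.2)}).preimage h
  have hsymm : ∀ a b : X, (a, b) ∈ K → (b, a) ∈ K := by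
    intro a b h
    simp only [K, C, mem_iUnion, mem_setOf_eq] at h ⊢
    obtain ⟨d, j, h1, h2, h3, h4⟩ := h
    exact ⟨d, j, h1.symm, h2.symm, h3.symm, h4.symm⟩
  have hirr : ∀ a : X, (a, a) ∉ K := by
    intro a h
    simp only [K, C, mem_iUnion, mem_setOf_eq] at h
    obtain ⟨d, j, h1, -⟩ := h
    exact h1 rfl
  rcases oca X K hK hsymm hirr with ⟨Y, hY, hYK⟩ | ⟨Y, hY, hYK⟩
  · exfalso
    -- the union of the graphs
    let O : Set (List Bool × S) := ⋃ p ∈ Y, Gr p.1.1 p.1.2.1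
    have hval : ∀ p : X, p.1.2.2.1 = chi (F (Gr p.1.1 p.1.2.1)) ∧
        p.1.2.2.2 = chi (H (range (nd p.1.1))) := by
      rintro ⟨_, ⟨p, rfl⟩⟩; exact ⟨rfl, rfl⟩
    have hO : ∀ p ∈ Y, O ∩ {q | q.1 ∈ range (nd p.1.1)} = Gr p.1.1 p.1.2.1 := by
      intro p hp
      ext ⟨t, s⟩
      simp only [O, mem_inter_iff, mem_iUnion, mem_setOf_eq, exists_prop, mem_range]
      constructor
      · rintro ⟨⟨q, hq, i, hi⟩, i', hi'⟩
        obtain ⟨rfl, rfl⟩ := Prod.mk.inj hi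
        obtain rfl := nd_eq_len hi'
        refine ⟨i', ?_⟩
        rw [hi']
        by_cases hpq : p = q
        · rw [hpq]
        · have := hYK p hp q hq hpq
          simp only [K, C, mem_iUnion, mem_setOf_eq] at this
          obtain ⟨d, j, h1, h2, h3, -⟩ := this
          have hd : i' ≤ d := by
            by_contra hlt
            exact h1 (nd_eq.1 hi' d (not_le.1 hlt))
          rw [h3 i' (Nat.lt_succ_of_le hd)]
      · rintro ⟨i, hi⟩
        obtain ⟨rfl, rfl⟩ := Prod.mk.inj hi
        exact ⟨⟨p, hp, i, rfl⟩, i, rfl⟩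
    have hm : ∀ p : X, ∃ m, p ∈ Y → ∀ j ≥ m,
        (j ∈ F (Gr p.1.1 p.1.2.1) ↔ j ∈ F O ∧ j ∈ H (range (nd p.1.1))) := by
      intro p
      by_cases hp : p ∈ Y
      · have := hFH O (range (nd p.1.1))
        rw [hO p hp] at this
        obtain ⟨m, hm⟩ := eventually_atTop.1 this
        exact ⟨m, fun _ => hm⟩
      · exact ⟨0, fun h => absurd h hp⟩
    choose m hm using hm
    apply hY
    let code : X → ℕ × List Bool × List Bool :=
      fun p => (m p, nd p.1.2.2.1 (m p), nd p.1.2.2.2 (m p))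
    refine (Set.mapsTo_univ code Y).countable_of_injOn ?_ (Set.to_countable _)
    intro p hp q hq hpq
    by_contra hne
    have := hYK p hp q hq hne
    simp only [K, C, mem_iUnion, mem_setOf_eq] at this
    obtain ⟨d, j, -, -, -, h4⟩ := this
    simp only [code, Prod.mk.injEq] at hpq
    obtain ⟨e1, e2, e3⟩ := hpq
    rw [← e1, nd_eq] at e2 e3
    apply h4
    by_cases hj : j < m p
    · rw [e2 j hj, e3 j hj]
    · have hp' := hm p hp j (not_lt.1 hj)
      have hq' := hm q hq j (e1 ▸ not_lt.1 hj)
      rw [(hval p).1, (hval p).2, (hval q).1, (hval q).2]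
      rw [Bool.eq_iff_iff]
      simp only [chi, Bool.and_eq_true, decide_eq_true_eq]
      tauto
  · refine ⟨fun N => {p | (⟨ι p, p, rfl⟩ : X) ∈ Y N}, ?_, ?_⟩
    · intro p
      have : (⟨ι p, p, rfl⟩ : X) ∈ ⋃ n, Y n := by rw [hY]; trivial
      obtain ⟨N, hN⟩ := mem_iUnion.1 this
      exact ⟨N, hN⟩
    · intro N x b y c hx hy d h1 h2 h3 j
      by_contra h4
      have hne : (⟨ι (x, b), (x, b), rfl⟩ : X) ≠ ⟨ι (y, c), (y, c), rfl⟩ := by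
        intro h
        have := congrArg (fun p : X => p.1.1 d) h
        exact h1 this
      refine hYK N _ hx _ hy hne ?_
      simp only [K, C, mem_iUnion, mem_setOf_eq]
      refine ⟨d, j, h1, h2, h3, ?_⟩
      intro h
      apply h4
      rw [Bool.eq_iff_iff] at h
      simpa [ι, chi] using h

lemma exists_first_diff {S : Type} {x y : ℕ → S} (h : x ≠ y) : ∃ d, x d ≠ y d ∧ Ag d x y := by
  classical
  have h' : ∃ d, x d ≠ y d := by
    by_contra hc
    push Not at hc
    exact h (funext hc)
  refine ⟨Nat.find h', Nat.find_spec h', fun i hi => ?_⟩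
  have := Nat.find_min h' hi
  simpa using this

theorem oca_lemma2 (oca : OCA) {S : Type} [TopologicalSpace S] [DiscreteTopology S] [Countable S]
    [Nonempty S]
    (F : Set (List Bool × S) → Set ℕ) (H : Set (List Bool) → Set ℕ)
    (hFH : ∀ O E, ∀ᶠ j in atTop, (j ∈ F (O ∩ {p | p.1 ∈ E}) ↔ j ∈ F O ∧ j ∈ H E)) :
    ∃ (x : ℕ → Bool) (Z : ℕ → Set (ℕ → S)), IsMeagre (⋃ N, Z N)ᶜ ∧
      (∀ N V, IsOpen V → (Z N ∩ V).Nonempty → ¬ IsMeagre (Z N ∩ V)) ∧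
      ∀ N, ∀ j ∈ H (range (nd x)), ∀ b ∈ Z N, ∃ k, ∀ b' ∈ Z N, Ag k b' b →
        (j ∈ F (Gr x b') ↔ j ∈ F (Gr x b)) := by
  obtain ⟨X, hX, hXK⟩ := oca_lemma1 oca F H hFH
  let h : (ℕ → Bool) → ℕ → Bool := fun x => chi (H (range (nd x)))
  let Good : ℕ → ℕ → (ℕ → Bool) → (ℕ → S) → Prop := fun N k0 x b =>
    ∃ k ≥ k0, ∃ y c, (y, c) ∈ X N ∧ Ag k x y ∧ x k ≠ y k ∧ Ag (k+1) b c ∧ Ag k0 (h x) (h y)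
  let Bad : ℕ × ℕ × List Bool × List Bool → (ℕ → Bool) → Set (ℕ → S) := fun κ x =>
    {b | (x, b) ∈ X κ.1 ∧ nd x κ.2.1 = κ.2.2.1 ∧ nd (h x) κ.2.1 = κ.2.2.2 ∧ ¬ Good κ.1 κ.2.1 x b}
  have hcount : ∀ κ, {x | ¬ IsNowhereDense (Bad κ x)}.Countable := by
    rintro ⟨N, k0, w, v⟩
    have : ∀ x, ∃ b k, ¬ IsNowhereDense (Bad (N, k0, w, v) x) →
        ∀ c, Ag k c b → ∀ l, ∃ a ∈ Bad (N, k0, w, v) x, Ag l a c := by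
      intro x
      by_cases hx : IsNowhereDense (Bad (N, k0, w, v) x)
      · exact ⟨fun _ => Classical.arbitrary S, 0, fun h => absurd hx h⟩
      · obtain ⟨b, k, hbk⟩ := somewhere_dense hx
        exact ⟨b, k, fun _ => hbk⟩
    choose b k hbk using this
    refine (Set.mapsTo_univ (fun x => nd (b x) (k x)) _).countable_of_injOn ?_ (Set.to_countable _)
    intro x hx y hy hxy
    by_contra hne
    obtain ⟨d, hd, hd'⟩ := exists_first_diff hne
    have hk := nd_eq_len hxy
    simp only [← hk, nd_eq] at hxy
    obtain ⟨a, ha, hab⟩ := hbk x hx (b x) (Ag.refl _ _) (k x)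
    obtain ⟨a', ha', hab'⟩ := hbk y hy a (hk ▸ hab.trans hxy) (d+1)
    have hkd : k0 ≤ d := by
      by_contra hlt
      have : nd x k0 = nd y k0 := ha.2.1.trans ha'.2.1.symm
      exact hd (nd_eq.1 this d (not_le.1 hlt))
    have hh : nd (h x) k0 = nd (h y) k0 := ha.2.2.1.trans ha'.2.2.1.symm
    exact ha.2.2.2 ⟨d, hkd, y, a', ha'.1, hd', hd, hab'.symm, nd_eq.1 hh⟩
  obtain ⟨x, hx⟩ : ∃ x, ∀ κ, IsNowhereDense (Bad κ x) := by
    by_contra hc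
    push Not at hc
    have : (univ : Set (ℕ → Bool)) = ⋃ κ, {x | ¬ IsNowhereDense (Bad κ x)} := by
      ext x; simpa using hc x
    have h2 : (univ : Set (ℕ → Bool)).Countable := by
      rw [this]; exact countable_iUnion hcount
    rw [countable_univ_iff] at h2
    have hinj : Function.Injective chi := by
      intro A B hAB
      ext i
      exact chi_iff.1 (congrFun hAB i)
    obtain ⟨f, hf⟩ := h2.exists_injective_nat
    exact Function.cantor_injective _ (hf.comp hinj)
  let Z0 : ℕ → Set (ℕ → S) := fun N => {b | (x, b) ∈ X N ∧ ∀ k0, Good N k0 x b}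
  let M : ℕ → Set (ℕ → S) := fun N =>
    ⋃ r : List S, ⋃ _ : IsMeagre (Z0 N ∩ {b | nd b r.length = r}), Z0 N ∩ {b | nd b r.length = r}
  have hM : ∀ N, IsMeagre (M N) := by
    intro N
    refine isMeagre_iUnion fun r => ?_
    by_cases hr : IsMeagre (Z0 N ∩ {b | nd b r.length = r})
    · simpa [hr] using hr
    · simp only [hr, iUnion_false]
      exact IsMeagre.empty
  refine ⟨x, fun N => Z0 N \ M N, ?_, ?_, ?_⟩
  · have h1 : IsMeagre ((⋃ κ, Bad κ x) ∪ ⋃ N, M N) :=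
      (isMeagre_iUnion fun κ => (hx κ).isMeagre).union (isMeagre_iUnion hM)
    refine h1.mono ?_
    intro b hb
    by_contra hc
    simp only [mem_union, mem_iUnion, not_or, not_exists] at hc
    obtain ⟨N, hN⟩ := hX (x, b)
    apply hb
    refine mem_iUnion.2 ⟨N, ⟨hN, fun k0 => ?_⟩, hc.2 N⟩
    by_contra hg
    exact hc.1 (N, k0, nd x k0, nd (h x) k0) ⟨hN, rfl, rfl, hg⟩
  · rintro N V hV ⟨b, ⟨hb, hbM⟩, hbV⟩ hm
    apply hbM
    obtain ⟨k, hk⟩ := exists_cyl hV hbV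
    have h3 : IsMeagre (Z0 N ∩ {c | nd c (nd b k).length = nd b k}) := by
      refine ((hm.union (hM N))).mono ?_
      rintro c ⟨hc, hck⟩
      by_cases hcM : c ∈ M N
      · exact Or.inr hcM
      · refine Or.inl ⟨⟨hc, hcM⟩, hk c ?_⟩
        have : nd c (nd b k).length = nd b k := hck
        rw [nd_len, nd_eq] at this
        exact this
    refine mem_iUnion₂.2 ⟨nd b k, h3, hb, ?_⟩
    show nd b (nd b k).length = nd b k
    rw [nd_len]
  · rintro N j hj b ⟨⟨hb, hb2⟩, -⟩
    obtain ⟨k, hk, y, c, hyc, hxy, hne, hbc, hh⟩ := hb2 (j+1)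
    have hjy : j ∈ H (range (nd y)) := (chi_iff.1 (hh j (Nat.lt_succ_self j))).1 hj
    refine ⟨k+1, ?_⟩
    rintro b' ⟨⟨hb', -⟩, -⟩ hbb'
    have e1 := hXK N x b y c hb hyc k hne hxy hbc j
    have e2 := hXK N x b' y c hb' hyc k hne hxy (hbb'.trans hbc) j
    tauto

/-- a dense and extension-closed family of conditions (with a monotone parameter) -/
structure DC {S : Type} (P : ℕ → (ℕ → S) → ℕ → Prop) : Prop where
  dense : ∀ b k, ∃ g b' k', k ≤ k' ∧ Ag k b' b ∧ P g b' k'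
  closed : ∀ g b k g' b' k', P g b k → g ≤ g' → k ≤ k' → Ag k b' b → P g' b' k'

lemma DC.and {S : Type} {P Q : ℕ → (ℕ → S) → ℕ → Prop} (hP : DC P) (hQ : DC Q) :
    DC (fun g b k => P g b k ∧ Q g b k) where
  dense b k := by
    obtain ⟨g, b1, k1, h1, h2, h3⟩ := hP.dense b k
    obtain ⟨g', b2, k2, h4, h5, h6⟩ := hQ.dense b1 k1
    exact ⟨max g g', b2, k2, h1.trans h4, (h5.mono h1).trans h2,
      hP.closed _ _ _ _ _ _ h3 (le_max_left _ _) h4 h5,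
      hQ.closed _ _ _ _ _ _ h6 (le_max_right _ _) le_rfl (Ag.refl _ _)⟩
  closed g b k g' b' k' h hg hk hb :=
    ⟨hP.closed _ _ _ _ _ _ h.1 hg hk hb, hQ.closed _ _ _ _ _ _ h.2 hg hk hb⟩

lemma DC.forall_lt {S : Type} {P : ℕ → ℕ → (ℕ → S) → ℕ → Prop} (hP : ∀ n, DC (P n)) (m : ℕ) :
    DC (fun g b k => ∀ n < m, P n g b k) := by
  induction m with
  | zero => exact ⟨fun b k => ⟨0, b, k, le_rfl, Ag.refl _ _, fun n hn => absurd hn (by omega)⟩,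
      fun g b k g' b' k' _ _ _ _ n hn => absurd hn (by omega)⟩
  | succ m ih =>
    have := ih.and (hP m)
    have e : (fun g b k => ∀ n < m + 1, P n g b k) =
        fun g b k => (∀ n < m, P n g b k) ∧ P m g b k := by
      funext g b k
      refine propext ⟨fun h => ⟨fun n hn => h n (by omega), h m (by omega)⟩, fun h n hn => ?_⟩
      rcases Nat.lt_succ_iff_lt_or_eq.1 hn with h' | rfl
      · exact h.1 n h'
      · exact h.2
    rw [e]; exact this

lemma DC.shift {P : ℕ → (ℕ → Bool) → ℕ → Prop} (hP : DC P) (m : ℕ) :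
    ∃ k ≥ m, ∃ (τ : ℕ → Bool) (g : ℕ), ∀ b : ℕ → Bool,
      (∀ i, m ≤ i → i < k → b i = τ i) → P g b k := by
  suffices H : ∀ A : Finset (Fin m → Bool), ∃ k ≥ m, ∃ (τ : ℕ → Bool) (g : ℕ), ∀ b : ℕ → Bool,
      (fun i : Fin m => b i) ∈ A → (∀ i, m ≤ i → i < k → b i = τ i) → P g b k by
    obtain ⟨k, hk, τ, g, h⟩ := H Finset.univ
    exact ⟨k, hk, τ, g, fun b => h b (Finset.mem_univ _)⟩
  intro A
  induction A using Finset.induction_on with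
  | empty => exact ⟨m, le_rfl, fun _ => true, 0, fun b h => absurd h (Finset.notMem_empty _)⟩
  | insert q A hq ih =>
    obtain ⟨k, hk, τ, g, h⟩ := ih
    obtain ⟨g', b', k', hk', hb', hP'⟩ :=
      hP.dense (fun i => if hi : i < m then q ⟨i, hi⟩ else τ i) k
    refine ⟨k', hk.trans hk', b', max g g', fun b hb hbb => ?_⟩
    rcases Finset.mem_insert.1 hb with hb | hb
    · refine hP.closed _ _ _ _ _ _ hP' (le_max_right _ _) le_rfl fun i hi => ?_
      by_cases him : i < m
      · have h1 := congrFun hb ⟨i, him⟩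
        have h2 := hb' i (lt_of_lt_of_le him hk)
        simp only [him, dif_pos] at h1 h2
        rw [h1, h2]
      · exact hbb i (not_lt.1 him) hi
    · refine hP.closed _ _ _ _ _ _ (h b hb fun i hmi hik => ?_) (le_max_left _ _) hk' (Ag.refl _ _)
      have h2 := hb' i hik
      simp only [not_lt.2 hmi, dif_neg, not_false_eq_true] at h2
      rw [hbb i hmi (lt_of_lt_of_le hik hk'), h2]

theorem R1core (Z : ℕ → Set (ℕ → Bool)) (hZ : IsMeagre (⋃ N, Z N)ᶜ)
    (hZ2 : ∀ N V, IsOpen V → (Z N ∩ V).Nonempty → ¬ IsMeagre (Z N ∩ V))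
    (w : ℕ → Set ℕ) (D : (ℕ → Bool) → Set ℕ)
    (hloc : ∀ N m, ∀ j ∈ w m, ∀ b ∈ Z N, ∃ k, ∀ b' ∈ Z N, Ag k b' b → (j ∈ D b' ↔ j ∈ D b))
    (hD : ∀ b m, ∀ᶠ j in atTop, j ∈ w m → (j ∈ D b ↔ b m = true)) :
    ∃ (m : ℕ → ℕ) (σ : ℕ → Bool) (g : ℕ → ℕ), StrictMono m ∧
      ∀ (E : Set ℕ) (b : ℕ → Bool), (∀ i, b (m i) = true ↔ i ∈ E) →
        (∀ p, p ∉ range m → b p = σ p) →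
        ∀ᶠ i in atTop, ∀ j ≥ g i, j ∈ w (m i) → (j ∈ D b ↔ i ∈ E) := by
  rw [IsMeagre, compl_compl] at hZ
  obtain ⟨S, hSo, hSd, hSc, hSZ⟩ := mem_residual_iff.1 hZ
  obtain ⟨O, hO⟩ : ∃ O : ℕ → Set (ℕ → Bool), (∀ n, IsOpen (O n)) ∧ (∀ n, Dense (O n)) ∧
      ⋂ n, O n ⊆ ⋃ N, Z N := by
    rcases S.eq_empty_or_nonempty with h | h
    · refine ⟨fun _ => univ, fun _ => isOpen_univ, fun _ => dense_univ, ?_⟩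
      simpa [h] using hSZ
    · obtain ⟨O, rfl⟩ := hSc.exists_eq_range h
      exact ⟨O, fun n => hSo _ ⟨n, rfl⟩, fun n => hSd _ ⟨n, rfl⟩, by rwa [sInter_range] at hSZ⟩
  obtain ⟨hOo, hOd, hOZ⟩ := hO
  have hP : ∀ n, DC (fun (_ : ℕ) (b : ℕ → Bool) k => ∀ c, Ag k c b → c ∈ O n) := by
    intro n
    constructor
    · intro b k
      obtain ⟨c, hc, hcO⟩ := (hOd n).exists_mem_open (isOpen_cyl b k) ⟨b, Ag.refl _ _⟩
      obtain ⟨l, hl⟩ := exists_cyl (hOo n) hc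
      exact ⟨0, c, max k l, le_max_left _ _, hcO, fun c' hc' => hl c' (hc'.mono (le_max_right _ _))⟩
    · intro g b k g' b' k' h _ hk hb c hc
      exact h c ((hc.mono hk).trans hb)
  have hQ : ∀ m N, DC (fun (g : ℕ) (b : ℕ → Bool) k => ∀ c ∈ Z N, Ag k c b → ∀ j ≥ g, j ∈ w m →
      (j ∈ D c ↔ c m = true)) := by
    intro m N
    constructor
    · intro b k
      by_cases hne : (Z N ∩ {c | Ag k c b}).Nonempty
      · have hnm := hZ2 N _ (isOpen_cyl b k) hne
        let A : ℕ → Set (ℕ → Bool) := fun g =>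
          {c | c ∈ Z N ∧ Ag k c b ∧ ∀ j ≥ g, j ∈ w m → (j ∈ D c ↔ c m = true)}
        obtain ⟨g, hg⟩ : ∃ g, ¬ IsMeagre (A g) := by
          by_contra hc
          push Not at hc
          refine hnm ((isMeagre_iUnion hc).mono ?_)
          rintro c ⟨hcZ, hcb⟩
          obtain ⟨g, hg⟩ := eventually_atTop.1 (hD c m)
          exact mem_iUnion.2 ⟨g, hcZ, hcb, hg⟩
        obtain ⟨b', k', hbk⟩ := somewhere_dense (fun h => hg (IsNowhereDense.isMeagre h))
        obtain ⟨a, ha, hab⟩ := hbk b' (Ag.refl _ _) k'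
        refine ⟨g, a, max k k', le_max_left _ _, ha.2.1, fun c hc hca j hj hjw => ?_⟩
        obtain ⟨k3, hk3⟩ := hloc N m j hjw c hc
        obtain ⟨a', ha', hac⟩ := hbk c ((hca.mono (le_max_right _ _)).trans hab) (max k3 (m+1))
        rw [← hk3 a' ha'.1 (hac.mono (le_max_left _ _)), ha'.2.2 j hj hjw,
          hac m (lt_of_lt_of_le (Nat.lt_succ_self m) (le_max_right _ _))]
      · refine ⟨0, b, k, le_rfl, Ag.refl _ _, fun c hc hcb => absurd ⟨c, hc, hcb⟩ hne⟩
    · intro g b k g' b' k' h hg hk hb c hc hcb j hj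
      exact h c hc ((hcb.mono hk).trans hb) j (hg.trans hj)
  have hall := fun m => ((DC.forall_lt hP (m+1)).and (DC.forall_lt (hQ m) (m+1))).shift (m+1)
  choose k hk τ g hkτ using hall
  obtain ⟨m, hm⟩ : ∃ m : ℕ → ℕ, ∀ i, m (i+1) = k (m i) :=
    ⟨fun i => Nat.rec (motive := fun _ => ℕ) 0 (fun _ p => k p) i, fun i => rfl⟩
  have hmono : StrictMono m := strictMono_nat_of_lt_succ fun i => by
    rw [hm]; exact hk (m i)
  classical
  let σ : ℕ → Bool := fun p => if h : ∃ i : ℕ, m i < p ∧ p < m (i+1) then τ (m h.choose) p else true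
  have hσ : ∀ i p, m i < p → p < m (i+1) → σ p = τ (m i) p := by
    intro i p h1 h2
    have h : ∃ i, m i < p ∧ p < m (i+1) := ⟨i, h1, h2⟩
    have e : h.choose = i := by
      have h3 := h.choose_spec
      have h4 := hmono.lt_iff_lt.1 (h3.1.trans h2)
      have h5 := hmono.lt_iff_lt.1 (h1.trans h3.2)
      omega
    simp only [σ, dif_pos h, e]
  refine ⟨m, σ, fun i => g (m i), hmono, fun E b hbE hbσ => ?_⟩
  have key := fun i => hkτ (m i) b (by
    intro p h1 h2
    rw [← hm] at h2
    rw [hbσ p, hσ i p h1 h2]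
    rintro ⟨i', rfl⟩
    have h4 := hmono.lt_iff_lt.1 (show m i < m i' from h1)
    have h5 := hmono.lt_iff_lt.1 (show m i' < m (i+1) from h2)
    omega)
  have hbO : b ∈ ⋂ n, O n := by
    refine mem_iInter.2 fun n => ?_
    exact (key n).1 n (Nat.lt_succ_of_le (hmono.id_le n)) b (Ag.refl _ _)
  obtain ⟨N, hN⟩ := mem_iUnion.1 (hOZ hbO)
  filter_upwards [eventually_ge_atTop N] with i hi j hj hjw
  rw [(key i).2 N (Nat.lt_succ_of_le (hi.trans (hmono.id_le i))) b hN (Ag.refl _ _) j hj hjw, hbE]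

/-- a homomorphism modulo finite sets -/
structure AH {T : Type} (Θ : Set T → Set ℕ) : Prop where
  inter : ∀ E F, ∀ᶠ j in atTop, (j ∈ Θ (E ∩ F) ↔ j ∈ Θ E ∧ j ∈ Θ F)
  compl : ∀ E, ∀ᶠ j in atTop, (j ∈ Θ Eᶜ ↔ j ∉ Θ E)

lemma AH.empty {T : Type} {Θ : Set T → Set ℕ} (h : AH Θ) : ∀ᶠ j in atTop, j ∉ Θ ∅ := by
  have h1 := h.inter ∅ ∅ᶜ
  rw [inter_compl_self] at h1
  filter_upwards [h1, h.compl ∅] with j h1 h2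
  tauto

lemma AH.mono {T : Type} {Θ : Set T → Set ℕ} (h : AH Θ) {E F : Set T} (hEF : E ⊆ F) :
    ∀ᶠ j in atTop, j ∈ Θ E → j ∈ Θ F := by
  have h1 := h.inter E F
  rw [inter_eq_left.2 hEF] at h1
  filter_upwards [h1] with j h1
  tauto

lemma AH.disj {T : Type} {Θ : Set T → Set ℕ} (h : AH Θ) {E F : Set T} (hEF : E ∩ F = ∅) :
    ∀ᶠ j in atTop, ¬ (j ∈ Θ E ∧ j ∈ Θ F) := by
  have h1 := h.inter E F
  rw [hEF] at h1
  filter_upwards [h1, h.empty] with j h1 h2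
  tauto

lemma AH.union {T : Type} {Θ : Set T → Set ℕ} (h : AH Θ) (E F : Set T) :
    ∀ᶠ j in atTop, (j ∈ Θ (E ∪ F) ↔ j ∈ Θ E ∨ j ∈ Θ F) := by
  have e : E ∪ F = (Eᶜ ∩ Fᶜ)ᶜ := by rw [compl_inter, compl_compl, compl_compl]
  rw [e]
  filter_upwards [h.compl (Eᶜ ∩ Fᶜ), h.inter Eᶜ Fᶜ, h.compl E, h.compl F] with j h1 h2 h3 h4
  tauto

theorem R1 (oca : OCA) {Θ : Set ℕ → Set ℕ} (hΘ : AH Θ) :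
    ∃ α g : ℕ → ℕ, Function.Injective α ∧
      ∀ E : Set ℕ, ∀ᶠ i in atTop, i ∈ E → ∀ k ≥ g i, k ∈ Θ {α i} → k ∈ Θ (α '' E) := by
  classical
  let e : List Bool → ℕ := Encodable.encode
  have he : Function.Injective e := Encodable.encode_injective
  let F : Set (List Bool × Bool) → Set ℕ := fun O => Θ (e '' {t | (t, true) ∈ O})
  let H : Set (List Bool) → Set ℕ := fun E => Θ (e '' E)
  have hFH : ∀ O E, ∀ᶠ j in atTop, (j ∈ F (O ∩ {p | p.1 ∈ E}) ↔ j ∈ F O ∧ j ∈ H E) := by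
    intro O E
    have : e '' {t | (t, true) ∈ O ∩ {p | p.1 ∈ E}} = e '' {t | (t, true) ∈ O} ∩ e '' E := by
      rw [← image_inter he]; rfl
    simp only [F, H, this]
    exact hΘ.inter _ _
  obtain ⟨x, Z, hZ, hZ2, hloc⟩ := oca_lemma2 oca F H hFH
  let D : (ℕ → Bool) → Set ℕ := fun b => F (Gr x b)
  let A : (ℕ → Bool) → Set ℕ := fun b => {q | ∃ p, b p = true ∧ e (nd x p) = q}
  have hDA : ∀ b, D b = Θ (A b) := by
    intro b
    have : e '' {t | (t, true) ∈ Gr x b} = A b := by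
      ext q
      constructor
      · rintro ⟨t, ⟨i, hi⟩, rfl⟩
        obtain ⟨rfl, h2⟩ := Prod.mk.inj hi
        exact ⟨i, h2.symm, rfl⟩
      · rintro ⟨p, hp, rfl⟩
        exact ⟨nd x p, ⟨p, by rw [hp]⟩, rfl⟩
    simp only [D, F, this]
  let w : ℕ → Set ℕ := fun m => Θ {e (nd x m)} ∩ H (range (nd x))
  have hD : ∀ b m, ∀ᶠ j in atTop, j ∈ w m → (j ∈ D b ↔ b m = true) := by
    intro b m
    rw [hDA]
    by_cases hb : b m = true
    · filter_upwards [hΘ.mono (E := {e (nd x m)}) (F := A b) (by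
        rintro _ rfl; exact ⟨m, hb, rfl⟩)] with j hj hjw
      exact ⟨fun _ => hb, fun _ => hj hjw.1⟩
    · filter_upwards [hΘ.disj (E := {e (nd x m)}) (F := A b) (by
        ext q
        simp only [mem_inter_iff, mem_singleton_iff, mem_empty_iff_false, iff_false]
        rintro ⟨rfl, p, hp, hp'⟩
        have := nd_eq_len (he hp')
        exact hb (this ▸ hp))] with j hj hjw
      exact ⟨fun h => absurd ⟨hjw.1, h⟩ hj, fun h => absurd h hb⟩
  obtain ⟨m, σ, g, hm, hg⟩ := R1core Z hZ hZ2 w D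
    (fun N m j hj b hb => hloc N j hj.2 b hb) hD
  let α : ℕ → ℕ := fun i => e (nd x (m i))
  have hα : Function.Injective α := fun i i' h => hm.injective (nd_eq_len (he h))
  have hg2 : ∀ i, ∃ g2, ∀ j ≥ g2, j ∈ Θ {α i} → j ∈ H (range (nd x)) := by
    intro i
    exact eventually_atTop.1 (hΘ.mono (by rintro _ rfl; exact ⟨_, ⟨m i, rfl⟩, rfl⟩))
  choose g2 hg2 using hg2
  let β : Set ℕ → ℕ → Bool := fun E p => if p ∈ range m then decide (∃ i ∈ E, m i = p) else σ p
  have hβ : ∀ E i, β E (m i) = true ↔ i ∈ E := by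
    intro E i
    simp only [β, mem_range, exists_apply_eq_apply, if_true, decide_eq_true_eq]
    constructor
    · rintro ⟨i', hi', h⟩
      exact hm.injective h ▸ hi'
    · exact fun h => ⟨i, h, rfl⟩
  have hβ2 : ∀ E p, p ∉ range m → β E p = σ p := by
    intro E p hp
    simp only [β, if_neg hp]
  refine ⟨α, fun i => max (max (g i) (g2 i)) i, hα, fun E => ?_⟩
  have hu : A (β E) = α '' E ∪ A (β ∅) := by
    ext q
    constructor
    · rintro ⟨p, hp, rfl⟩
      by_cases hpm : p ∈ range m
      · obtain ⟨i, rfl⟩ := hpm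
        exact Or.inl ⟨i, (hβ E i).1 hp, rfl⟩
      · rw [hβ2 E p hpm, ← hβ2 ∅ p hpm] at hp
        exact Or.inr ⟨p, hp, rfl⟩
    · rintro (⟨i, hi, rfl⟩ | ⟨p, hp, rfl⟩)
      · exact ⟨m i, (hβ E i).2 hi, rfl⟩
      · by_cases hpm : p ∈ range m
        · obtain ⟨i, rfl⟩ := hpm
          exact absurd ((hβ ∅ i).1 hp) (notMem_empty _)
        · rw [hβ2 ∅ p hpm, ← hβ2 E p hpm] at hp
          exact ⟨p, hp, rfl⟩
  have hun := hΘ.union (α '' E) (A (β ∅))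
  rw [← hu, ← hDA, ← hDA] at hun
  obtain ⟨J, hJ⟩ := eventually_atTop.1 hun
  filter_upwards [eventually_ge_atTop J, hg E (β E) (hβ E) (hβ2 E), hg ∅ (β ∅) (hβ ∅) (hβ2 ∅)]
    with i hi h1 h2 hiE k hk hkα
  have hk1 : g i ≤ k := le_trans (le_trans (le_max_left _ _) (le_max_left _ _)) hk
  have hk2 : g2 i ≤ k := le_trans (le_trans (le_max_right _ _) (le_max_left _ _)) hk
  have hk3 : i ≤ k := le_trans (le_max_right _ _) hk
  have hw : k ∈ w (m i) := ⟨hkα, hg2 i k hk2 hkα⟩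
  have h3 := (h1 k hk1 hw).2 hiE
  rcases (hJ k (hi.trans hk3)).1 h3 with h | h
  · exact h
  · exact absurd ((h2 k hk1 hw).1 h) (notMem_empty _)

section lemmaC
variable {S : Type} [TopologicalSpace S] [DiscreteTopology S]

lemma nowhere_dense_of {A : Set (ℕ → S)}
    (h : ∀ b k, ∃ b' k', Ag k b' b ∧ ∀ c, Ag k' c b' → c ∉ A) : IsNowhereDense A := by
  by_contra hA
  obtain ⟨b, k, hbk⟩ := somewhere_dense hA
  obtain ⟨b', k', h1, h2⟩ := h b k
  obtain ⟨a, ha, haa⟩ := hbk b' h1 k'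
  exact h2 a haa ha

lemma generic_point {ι : Type} [Countable ι] {Y : Set (ℕ → S)} (hY : ¬ IsMeagre Y)
    (G : ι → Set (ℕ → S))
    (hG : ∀ n, ∀ b ∈ Y, ∀ l, ∃ b' ∈ Y, Ag l b' b ∧ ∃ k, ∀ c ∈ Y, Ag k c b' → c ∈ G n) :
    ∃ b ∈ Y, ∀ n, b ∈ G n := by
  by_contra hc
  push Not at hc
  refine hY ((isMeagre_iUnion (f := fun n => Y \ G n) fun n => ?_).mono ?_)
  · refine (nowhere_dense_of fun b k => ?_).isMeagre
    by_cases hb : ∃ c ∈ Y, Ag k c b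
    · obtain ⟨c, hcY, hcb⟩ := hb
      obtain ⟨b', hb', hbc, k', hk'⟩ := hG n c hcY k
      refine ⟨b', k', hbc.trans hcb, fun d hd hdA => hdA.2 (hk' d hdA.1 hd)⟩
    · exact ⟨b, k, Ag.refl _ _, fun c hcb hcA => hb ⟨c, hcA.1, hcb⟩⟩
  · intro b hb
    obtain ⟨n, hn⟩ := hc b hb
    exact mem_iUnion.2 ⟨n, hb, hn⟩

theorem lemmaC [Countable S] (D : (ℕ → S) → Set ℕ) (a : ℕ → Set ℕ)
    (hstar : ∀ b c : ℕ → S, ∀ᶠ i in atTop, b i = c i → ∀ j ∈ a i, (j ∈ D b ↔ j ∈ D c))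
    (Z : Set (ℕ → S)) (hne : Z.Nonempty)
    (hZ : ∀ V, IsOpen V → (Z ∩ V).Nonempty → ¬ IsMeagre (Z ∩ V)) (i0 : ℕ)
    (hloc : ∀ i ≥ i0, ∀ j ∈ a i, ∀ b ∈ Z, ∃ k, ∀ b' ∈ Z, Ag k b' b → (j ∈ D b' ↔ j ∈ D b)) :
    ∃ h : ℕ → S → Set ℕ, ∀ b, ∀ᶠ i in atTop, ∀ j ∈ a i, (j ∈ D b ↔ j ∈ h i (b i)) := by
  have hZm : ¬ IsMeagre Z := by
    have := hZ univ isOpen_univ (by simpa using hne)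
    simpa using this
  obtain ⟨b0, k0, hd⟩ := somewhere_dense (fun h => hZm (IsNowhereDense.isMeagre h))
  let Y : Set (ℕ → S) := Z ∩ {c | Ag k0 c b0}
  have hYd : ∀ c, Ag k0 c b0 → ∀ l, ∃ a ∈ Y, Ag l a c := by
    intro c hc l
    obtain ⟨a, ha, hac⟩ := hd c hc (max l k0)
    exact ⟨a, ⟨ha, (hac.mono (le_max_right _ _)).trans hc⟩, hac.mono (le_max_left _ _)⟩
  have hYm : ∀ b ∈ Y, ∀ l, ¬ IsMeagre (Y ∩ {c | Ag l c b}) := by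
    intro b hb l
    have e : Y ∩ {c | Ag l c b} = Z ∩ ({c | Ag k0 c b0} ∩ {c | Ag l c b}) := inter_assoc _ _ _
    rw [e]
    exact hZ _ ((isOpen_cyl _ _).inter (isOpen_cyl _ _)) ⟨b, hb.1, hb.2, Ag.refl _ _⟩
  obtain ⟨y0, hy0, -⟩ := hYd b0 (Ag.refl _ _) 0
  have hYm0 : ¬ IsMeagre Y := by
    have := hYm y0 hy0 0
    intro h
    exact this (h.mono inter_subset_left)
  let Bad : ℕ → (ℕ → S) → (ℕ → S) → Prop := fun i b c =>
    b i = c i ∧ ∃ j ∈ a i, ¬ (j ∈ D b ↔ j ∈ D c)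
  have hBo : ∀ i ≥ i0, ∀ b ∈ Y, ∀ c ∈ Y, Bad i b c → ∃ k, ∀ b' ∈ Y, ∀ c' ∈ Y,
      Ag k b' b → Ag k c' c → Bad i b' c' := by
    rintro i hi b hb c hc ⟨h1, j, hj, h2⟩
    obtain ⟨k1, hk1⟩ := hloc i hi j hj b hb.1
    obtain ⟨k2, hk2⟩ := hloc i hi j hj c hc.1
    refine ⟨max (i+1) (max k1 k2), fun b' hb' c' hc' hbb hcc => ?_⟩
    have hi' : i < max (i+1) (max k1 k2) := lt_of_lt_of_le (Nat.lt_succ_self i) (le_max_left _ _)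
    refine ⟨by rw [hbb i hi', hcc i hi', h1], j, hj, ?_⟩
    rw [hk1 b' hb'.1 (hbb.mono ((le_max_left _ _).trans (le_max_right _ _))),
      hk2 c' hc'.1 (hcc.mono ((le_max_right _ _).trans (le_max_right _ _)))]
    exact h2
  have hfin : ∀ b c, ∃ m, ∀ i ≥ m, ¬ Bad i b c := by
    intro b c
    obtain ⟨m, hm⟩ := eventually_atTop.1 (hstar b c)
    refine ⟨m, fun i hi hB => ?_⟩
    obtain ⟨h1, j, hj, h2⟩ := hB
    exact h2 (hm i hi h1 j hj)
  by_cases hA : ∀ m, ∀ b ∈ Y, ∀ c ∈ Y, ∀ l, ∃ i ≥ max m i0, ∃ b' ∈ Y, ∃ c' ∈ Y,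
      Ag l b' b ∧ Ag l c' c ∧ Bad i b' c'
  · exfalso
    let G : ℕ × List S → Set (ℕ → S) := fun q => {b | (∃ c ∈ Y, nd c q.2.length = q.2) →
      ∃ i ≥ max q.1 i0, ∃ c ∈ Y, nd c q.2.length = q.2 ∧ Bad i b c}
    obtain ⟨b, hb, hbG⟩ := generic_point hYm0 G (by
      rintro ⟨m, r⟩ b hb l
      by_cases hr : ∃ c ∈ Y, nd c r.length = r
      · obtain ⟨c, hc, hcr⟩ := hr
        obtain ⟨i, hi, b', hb', c', hc', h1, h2, h3⟩ := hA m b hb c hc (max l r.length)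
        obtain ⟨k, hk⟩ := hBo i ((le_max_right _ _).trans hi) b' hb' c' hc' h3
        refine ⟨b', hb', h1.mono (le_max_left _ _), k, fun d hd hdb _ =>
          ⟨i, hi, c', hc', ?_, hk d hd c' hc' hdb (Ag.refl _ _)⟩⟩
        show nd c' r.length = r
        rw [← nd_eq.2 (h2.mono (le_max_right _ _)).symm, hcr]
      · exact ⟨b, hb, Ag.refl _ _, 0, fun d _ _ h => absurd h hr⟩)
    obtain ⟨c, hc, hcG⟩ := generic_point hYm0 (fun m : ℕ => {c | ∃ i ≥ m, Bad i b c}) (by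
      intro m c hc l
      obtain ⟨i, hi, c', hc', h1, h2⟩ := hbG (m, nd c l) ⟨c, hc, by
        show nd c (nd c l).length = nd c l
        rw [nd_len]⟩
      have h1' : nd c' (nd c l).length = nd c l := h1
      rw [nd_len, nd_eq] at h1'
      obtain ⟨k, hk⟩ := hBo i ((le_max_right _ _).trans hi) b hb c' hc' h2
      exact ⟨c', hc', h1', k, fun d hd hdc =>
        ⟨i, (le_max_left _ _).trans hi, hk b hb d hd (Ag.refl _ _) hdc⟩⟩)
    obtain ⟨m, hm⟩ := hfin b c
    obtain ⟨i, hi, hB⟩ := hcG m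
    exact hm i hi hB
  · push Not at hA
    obtain ⟨m, b1, hb1, c1, hc1, l, hB⟩ := hA
    have hc : ∀ i s, ∃ c : ℕ → S, max l k0 ≤ i → c ∈ Y ∧ Ag l c c1 ∧ c i = s := by
      intro i s
      by_cases hi : max l k0 ≤ i
      · obtain ⟨c, hc, hcc⟩ := hYd (Function.update c1 i s) (by
          intro p hp
          have : p ≠ i := by have := le_max_right l k0; omega
          rw [Function.update_of_ne this]
          exact hc1.2 p hp) (i+1)
        refine ⟨c, fun _ => ⟨hc, ?_, ?_⟩⟩
        · intro p hp
          have : p ≠ i ∧ p < i + 1 := by have := le_max_left l k0; omega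
          rw [hcc p this.2, Function.update_of_ne this.1]
        · rw [hcc i (Nat.lt_succ_self i), Function.update_self]
      · exact ⟨c1, fun h => absurd h hi⟩
    choose c hc using hc
    refine ⟨fun i s => D (c i s), fun b => ?_⟩
    by_contra hcon
    have hfreq : ∀ n, ∃ i ≥ n, ∃ j ∈ a i, ¬ (j ∈ D b ↔ j ∈ D (c i (b i))) := by
      intro n
      by_contra h
      push Not at h
      refine hcon ?_
      filter_upwards [eventually_ge_atTop n] with i hi j hj
      have := h i hi j hj
      tauto
    obtain ⟨b', hb', hbG⟩ := generic_point (hYm b1 hb1 l)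
      (fun n : ℕ => {b' | ∃ i ≥ n, (∃ j ∈ a i, ¬ (j ∈ D b ↔ j ∈ D (c i (b i)))) ∧ b' i = b i}) (by
        rintro n d ⟨hdY, hdl⟩ l'
        obtain ⟨i, hi, hij⟩ := hfreq (max n (max l' (max l k0)))
        have hi1 : n ≤ i ∧ l' ≤ i ∧ l ≤ i ∧ k0 ≤ i := by
          simp only [ge_iff_le, max_le_iff] at hi
          exact hi
        obtain ⟨d', hd', hdd⟩ := hYd (Function.update d i (b i)) (by
          intro p hp
          have : p ≠ i := by omega
          rw [Function.update_of_ne this]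
          exact hdY.2 p hp) (i+1)
        have hAg : ∀ q ≤ i, Ag q d' d := by
          intro q hq p hp
          have : p ≠ i ∧ p < i + 1 := by omega
          rw [hdd p this.2, Function.update_of_ne this.1]
        refine ⟨d', ⟨hd', (hAg l hi1.2.2.1).trans hdl⟩, hAg l' hi1.2.1, i+1,
          fun f _ hf => ⟨i, hi1.1, hij, ?_⟩⟩
        rw [hf i (Nat.lt_succ_self i), hdd i (Nat.lt_succ_self i), Function.update_self])
    obtain ⟨m', hm'⟩ := eventually_atTop.1 (hstar b' b)
    obtain ⟨i, hi, ⟨j, hj, hjD⟩, hib⟩ := hbG (max m' (max (max m i0) (max l k0)))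
    have hi1 : m' ≤ i ∧ max m i0 ≤ i ∧ max l k0 ≤ i := by
      simp only [ge_iff_le, max_le_iff] at hi ⊢
      exact hi
    obtain ⟨hcY, hcl, hcb⟩ := hc i (b i) hi1.2.2
    have h1 := hm' i hi1.1 hib j hj
    have h2 := hB i hi1.2.1 b' hb'.1 _ hcY hb'.2 hcl
    apply h2
    refine ⟨by rw [hib, hcb], j, hj, ?_⟩
    tauto

end lemmaC

theorem combo (oca : OCA) {S : Type} [Countable S] [Nonempty S]
    (F : Set (List Bool × S) → Set ℕ) (H : Set (List Bool) → Set ℕ)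
    (hFH : ∀ O E, ∀ᶠ j in atTop, (j ∈ F (O ∩ {p | p.1 ∈ E}) ↔ j ∈ F O ∧ j ∈ H E)) :
    ∃ x : ℕ → Bool, ∀ a : ℕ → Set ℕ,
      (∀ b c : ℕ → S, ∀ᶠ i in atTop, b i = c i → ∀ j ∈ a i, (j ∈ F (Gr x b) ↔ j ∈ F (Gr x c))) →
      (∀ᶠ i in atTop, a i ⊆ H (range (nd x))) →
      ∃ h : ℕ → S → Set ℕ, ∀ b, ∀ᶠ i in atTop, ∀ j ∈ a i, (j ∈ F (Gr x b) ↔ j ∈ h i (b i)) := by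
  letI : TopologicalSpace S := ⊥
  haveI : DiscreteTopology S := ⟨rfl⟩
  obtain ⟨x, Z, hZ, hZ2, hloc⟩ := oca_lemma2 oca F H hFH
  refine ⟨x, fun a hstar hH => ?_⟩
  obtain ⟨i0, hi0⟩ := eventually_atTop.1 hH
  obtain ⟨b, hb⟩ : (⋃ N, Z N).Nonempty := by
    rw [IsMeagre, compl_compl] at hZ
    exact (dense_of_mem_residual hZ).nonempty
  obtain ⟨N, hN⟩ := mem_iUnion.1 hb
  exact lemmaC (fun b => F (Gr x b)) a hstar (Z N) ⟨b, hN⟩ (hZ2 N) i0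
    (fun i hi j hj b hb => hloc N j (hi0 i hi hj) b hb)

theorem finalContra (oca : OCA) (μ : Measure CSp) (hμ : IsMeasureOK μ) (rep : Set CSp → Set ℕ)
    (ri : ∀ A B, MeasurableSet A → MeasurableSet B →
      ∀ᶠ j in atTop, (j ∈ rep (A ∩ B) ↔ j ∈ rep A ∧ j ∈ rep B))
    (rc : ∀ A, MeasurableSet A → ∀ᶠ j in atTop, (j ∈ rep Aᶜ ↔ j ∉ rep A))
    (rn : ∀ A, MeasurableSet A → (∀ᶠ j in atTop, j ∉ rep A) → μ A = 0) : False := by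
  classical
  have rmono : ∀ A B, MeasurableSet A → MeasurableSet B → A ⊆ B →
      ∀ᶠ j in atTop, j ∈ rep A → j ∈ rep B := by
    intro A B hA hB hAB
    have h1 := ri A B hA hB
    rw [inter_eq_left.2 hAB] at h1
    filter_upwards [h1] with j h1
    tauto
  have runion : ∀ A B, MeasurableSet A → MeasurableSet B →
      ∀ᶠ j in atTop, (j ∈ rep (A ∪ B) ↔ j ∈ rep A ∨ j ∈ rep B) := by
    intro A B hA hB
    have e : A ∪ B = (Aᶜ ∩ Bᶜ)ᶜ := by rw [compl_inter, compl_compl, compl_compl]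
    rw [e]
    filter_upwards [rc _ (hA.compl.inter hB.compl), ri _ _ hA.compl hB.compl, rc A hA, rc B hB]
      with j h1 h2 h3 h4
    tauto
  have hmE : ∀ E : Set ℕ, MeasurableSet (E ×ˢ (univ : Set Cant)) := fun E =>
    (MeasurableSet.of_discrete).prod MeasurableSet.univ
  let Θ : Set ℕ → Set ℕ := fun E => rep (E ×ˢ (univ : Set Cant))
  have hΘ : AH Θ := by
    constructor
    · intro E F
      have e : (E ∩ F) ×ˢ (univ : Set Cant) = E ×ˢ univ ∩ F ×ˢ univ := by ext p; simp
      simp only [Θ, e]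
      exact ri _ _ (hmE E) (hmE F)
    · intro E
      have e : Eᶜ ×ˢ (univ : Set Cant) = (E ×ˢ univ)ᶜ := by ext p; simp
      simp only [Θ, e]
      exact rc _ (hmE E)
  obtain ⟨α, g, hα, hg⟩ := R1 oca hΘ
  have hg' : ∀ i, ∃ m, g i ≤ m ∧ i ≤ m ∧ ∀ i' < i, ∀ j ≥ m, ¬ (j ∈ Θ {α i} ∧ j ∈ Θ {α i'}) := by
    intro i
    have : ∀ᶠ j in atTop, ∀ i' ∈ Set.Iio i, ¬ (j ∈ Θ {α i} ∧ j ∈ Θ {α i'}) := by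
      refine (Set.finite_Iio i).eventually_all.2 fun i' hi' => hΘ.disj ?_
      ext q
      simp only [mem_inter_iff, mem_singleton_iff, mem_empty_iff_false, iff_false]
      rintro ⟨rfl, h⟩
      exact absurd (hα h) (ne_of_gt hi')
    obtain ⟨m, hm⟩ := eventually_atTop.1 this
    refine ⟨max (max (g i) i) m, (le_max_left _ _).trans (le_max_left _ _),
      (le_max_right _ _).trans (le_max_left _ _), fun i' hi' j hj => hm j ?_ i' hi'⟩
    exact (le_max_right _ _).trans hj
  choose g' hg1 hg2 hg3 using hg'
  let e : List Bool → ℕ := Encodable.encode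
  have he : Function.Injective e := Encodable.encode_injective
  let U : Set (List Bool × List Bool) → Set CSp := fun O => ⋃ p ∈ O, basic (α (e p.1)) p.2
  have hUm : ∀ O, MeasurableSet (U O) := fun O =>
    MeasurableSet.biUnion O.to_countable fun p _ => measurableSet_basic _ _
  let F : Set (List Bool × List Bool) → Set ℕ := fun O => rep (U O)
  let H : Set (List Bool) → Set ℕ := fun E => Θ (α '' (e '' E))
  have hFH : ∀ O E, ∀ᶠ j in atTop, (j ∈ F (O ∩ {p | p.1 ∈ E}) ↔ j ∈ F O ∧ j ∈ H E) := by
    intro O E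
    have : U (O ∩ {p | p.1 ∈ E}) = U O ∩ (α '' (e '' E)) ×ˢ univ := by
      ext ⟨n, z⟩
      simp only [U, mem_iUnion, mem_inter_iff, basic, mem_prod, mem_singleton_iff, mem_univ,
        and_true, exists_prop]
      constructor
      · rintro ⟨p, ⟨hp, hpE⟩, rfl, hz⟩
        exact ⟨⟨p, hp, rfl, hz⟩, _, ⟨_, hpE, rfl⟩, rfl⟩
      · rintro ⟨⟨p, hp, rfl, hz⟩, _, ⟨t, ht, rfl⟩, h⟩
        have := he (hα h)
        exact ⟨p, ⟨hp, show p.1 ∈ E from this ▸ ht⟩, rfl, hz⟩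
    simp only [F, H, Θ, this]
    exact ri _ _ (hUm O) (hmE _)
  obtain ⟨x, hx⟩ := combo oca F H hFH
  let γ : ℕ → ℕ := fun i => e (nd x i)
  have hγ : Function.Injective γ := fun i i' h => nd_eq_len (he h)
  have hγt : Tendsto γ atTop atTop := hγ.nat_tendsto_atTop
  let β : ℕ → ℕ := fun i => α (γ i)
  have hβ : Function.Injective β := hα.comp hγ
  let a : ℕ → Set ℕ := fun i => {k | k ∈ Θ {β i} ∧ g' (γ i) ≤ k}
  have up : ∀ P : ℕ → Prop, (∀ᶠ j in atTop, P j) → ∀ᶠ i in atTop, ∀ j ∈ a i, P j := by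
    intro P hP
    obtain ⟨J, hJ⟩ := eventually_atTop.1 hP
    filter_upwards [hγt.eventually_ge_atTop J] with i hi j hj
    exact hJ j ((hi.trans (hg2 _)).trans hj.2)
  have hA : ∀ E : Set ℕ, ∀ᶠ i in atTop, i ∈ E → a i ⊆ Θ (β '' E) := by
    intro E
    filter_upwards [hγt.eventually (hg (γ '' E))] with i hi hiE j hj
    have := hi ⟨i, hiE, rfl⟩ j ((hg1 _).trans hj.2) hj.1
    rwa [← image_comp] at this
  let V : (ℕ → List Bool) → Set CSp := fun b => ⋃ i, basic (β i) (b i)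
  have hVm : ∀ b, MeasurableSet (V b) := fun b =>
    MeasurableSet.iUnion fun i => measurableSet_basic _ _
  have hD : ∀ b, F (Gr x b) = rep (V b) := by
    intro b
    have : U (Gr x b) = V b := by
      ext z
      simp only [U, V, mem_iUnion, exists_prop]
      constructor
      · rintro ⟨_, ⟨i, rfl⟩, hz⟩
        exact ⟨i, hz⟩
      · rintro ⟨i, hz⟩
        exact ⟨_, ⟨i, rfl⟩, hz⟩
    simp only [F, this]
  obtain ⟨h, hh⟩ := hx a (by
    intro b c
    let E : Set ℕ := {i | b i = c i}
    have key : ∀ b c : ℕ → List Bool, (∀ i ∈ E, b i = c i) →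
        V b ∩ (β '' E) ×ˢ univ ⊆ V c ∩ (β '' E) ×ˢ univ := by
      rintro b c hbc ⟨n, z⟩ ⟨hz, hn⟩
      refine ⟨?_, hn⟩
      obtain ⟨i, hi⟩ := mem_iUnion.1 hz
      obtain ⟨i', hi', hn'⟩ := hn.1
      have e1 : n = β i := hi.1
      have : i' = i := hβ (hn'.trans e1)
      subst this
      refine mem_iUnion.2 ⟨i', ?_⟩
      rw [← hbc i' hi']
      exact hi
    have heq : V b ∩ (β '' E) ×ˢ univ = V c ∩ (β '' E) ×ˢ univ :=
      Subset.antisymm (key b c fun i hi => hi) (key c b fun i hi => Eq.symm hi)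
    have h1 := ri _ _ (hVm b) (hmE (β '' E))
    have h2 := ri _ _ (hVm c) (hmE (β '' E))
    rw [heq] at h1
    rw [hD, hD]
    filter_upwards [up _ h1, up _ h2, hA E] with i h1 h2 h3 hi j hj
    have h4 := h1 j hj
    have h5 := h2 j hj
    have h6 : j ∈ rep ((β '' E) ×ˢ univ) := h3 hi hj
    tauto) (by
    filter_upwards [hA univ] with i hi
    have := hi trivial
    have e1 : β '' univ = α '' (e '' range (nd x)) := by
      ext q
      constructor
      · rintro ⟨i, -, rfl⟩
        exact ⟨_, ⟨_, ⟨i, rfl⟩, rfl⟩, rfl⟩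
      · rintro ⟨_, ⟨_, ⟨i, rfl⟩, rfl⟩, rfl⟩
        exact ⟨i, trivial, rfl⟩
    rw [e1] at this
    exact this)
  simp only [hD] at hh
  have hsplit : ∀ᶠ i in atTop, ∀ s, ∀ j ∈ a i, j ∈ h i s →
      j ∈ h i (s ++ [false]) ∨ j ∈ h i (s ++ [true]) := by
    have hch : ∀ i, ∃ s, (∀ j ∈ a i, j ∈ h i s → j ∈ h i (s ++ [false]) ∨ j ∈ h i (s ++ [true])) →
        ∀ s, ∀ j ∈ a i, j ∈ h i s → j ∈ h i (s ++ [false]) ∨ j ∈ h i (s ++ [true]) := by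
      intro i
      by_contra hc
      push Not at hc
      obtain ⟨h1, s, j, h2, h3⟩ := hc []
      obtain ⟨h1', -⟩ := hc s
      have := h1' j h2 h3.1
      tauto
    choose s hs using hch
    have hsub : V s ⊆ V (fun i => s i ++ [false]) ∪ V (fun i => s i ++ [true]) := by
      rintro ⟨n, z⟩ hz
      obtain ⟨i, hn, hz⟩ := mem_iUnion.1 hz
      have key : ∀ v, z (s i).length = v → z ∈ cyl (s i ++ [v]) := by
        intro v hv ⟨p, hp⟩
        by_cases hps : p < (s i).length
        · have := hz ⟨p, hps⟩
          simpa [List.getElem_append_left hps] using this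
        · have hp' : p = (s i).length := by
            simp only [List.length_append, List.length_singleton] at hp
            omega
          subst hp'
          simpa using hv
      cases hv : z (s i).length
      · exact Or.inl (mem_iUnion.2 ⟨i, hn, key _ hv⟩)
      · exact Or.inr (mem_iUnion.2 ⟨i, hn, key _ hv⟩)
    filter_upwards [up _ (rmono _ _ (hVm _) ((hVm _).union (hVm _)) hsub),
      up _ (runion _ _ (hVm (fun i => s i ++ [false])) (hVm (fun i => s i ++ [true]))),
      hh s, hh (fun i => s i ++ [false]), hh (fun i => s i ++ [true])] with i h1 h2 h3 h4 h5
    refine hs i fun j hj hjs => ?_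
    rw [← h4 j hj, ← h5 j hj, ← h2 j hj]
    exact h1 j hj ((h3 j hj).2 hjs)
  have hroot : ∀ᶠ i in atTop, a i ⊆ h i [] := by
    filter_upwards [hh (fun _ => []), hA univ] with i h1 h2 j hj
    refine (h1 j hj).1 ?_
    have e1 : V (fun _ => []) = (β '' univ) ×ˢ univ := by
      ext ⟨n, z⟩
      simp only [V, basic, cyl, mem_iUnion, mem_prod, mem_singleton_iff, image_univ, mem_range,
        mem_univ, and_true]
      constructor
      · rintro ⟨i, hi, -⟩; exact ⟨i, hi.symm⟩
      · rintro ⟨i, hi⟩; exact ⟨i, hi.symm, fun q => q.elim0⟩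
    rw [e1]
    exact h2 trivial hj
  obtain ⟨I0, hI0⟩ := eventually_atTop.1 (hsplit.and hroot)
  have hs : ∀ i j, ∃ s : List Bool, s.length = j + 2 ∧ (I0 ≤ i → j ∈ a i → j ∈ h i s) := by
    intro i j
    by_cases hij : I0 ≤ i ∧ j ∈ a i
    · have : ∀ n, ∃ s : List Bool, s.length = n ∧ j ∈ h i s := by
        intro n
        induction n with
        | zero => exact ⟨[], rfl, (hI0 i hij.1).2 hij.2⟩
        | succ n ih =>
          obtain ⟨s, hs, hjs⟩ := ih
          rcases (hI0 i hij.1).1 s j hij.2 hjs with h' | h'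
          · exact ⟨_, by simp [hs], h'⟩
          · exact ⟨_, by simp [hs], h'⟩
      obtain ⟨s, h1, h2⟩ := this (j+2)
      exact ⟨s, h1, fun _ _ => h2⟩
    · exact ⟨List.replicate (j+2) true, by simp, fun h1 h2 => absurd ⟨h1, h2⟩ hij⟩
  choose s hslen hsh using hs
  let W : Set CSp := ⋃ i, ⋃ j, ⋃ _ : j ∈ a i, basic (β i) (s i j)
  have hWm : MeasurableSet W := MeasurableSet.iUnion fun i => MeasurableSet.iUnion fun j =>
    MeasurableSet.iUnion fun _ => measurableSet_basic _ _
  have hex : ∀ i, ∃ j ∈ a i, j ∉ rep W := by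
    intro i
    by_contra hc
    push Not at hc
    have h0 : μ (({β i} : Set ℕ) ×ˢ univ ∩ Wᶜ) = 0 := by
      refine rn _ ((hmE _).inter hWm.compl) ?_
      filter_upwards [ri _ _ (hmE {β i}) hWm.compl, rc _ hWm, eventually_ge_atTop (g' (γ i))]
        with j h1 h2 h3 h4
      have h5 := h1.1 h4
      exact h2.1 h5.2 (hc j ⟨h5.1, h3⟩)
    have h1 : basic (β i) [] ⊆ (({β i} : Set ℕ) ×ˢ univ ∩ Wᶜ) ∪ ⋃ j, basic (β i) (s i j) := by
      rintro ⟨n, z⟩ ⟨hn, -⟩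
      have hn' : n = β i := hn
      by_cases hz : (n, z) ∈ W
      · right
        simp only [W, mem_iUnion] at hz
        obtain ⟨i', j, hj, hn2, hz⟩ := hz
        have hn3 : n = β i' := hn2
        have : i' = i := hβ (hn3.symm.trans hn')
        subst this
        exact mem_iUnion.2 ⟨j, hn2, hz⟩
      · exact Or.inl ⟨⟨hn, trivial⟩, hz⟩
    have h2 : μ (basic (β i) []) ≤ ∑' j : ℕ, (2 : ℝ≥0∞)⁻¹ ^ (j + 2) := by
      refine (measure_mono h1).trans ((measure_union_le _ _).trans ?_)
      rw [h0, zero_add]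
      refine (measure_iUnion_le _).trans ?_
      simp only [hμ _ _, hslen]
      exact le_rfl
    rw [hμ] at h2
    simp only [pow_add, ENNReal.tsum_mul_right, ENNReal.tsum_geometric, ENNReal.one_sub_inv_two,
      inv_inv, List.length_nil, pow_zero] at h2
    rw [pow_two, ← mul_assoc, ENNReal.mul_inv_cancel (by norm_num) (by norm_num), one_mul] at h2
    simp at h2
  choose t ht htW using hex
  have hsub : V (fun i => s i (t i)) ⊆ W := by
    rintro z hz
    obtain ⟨i, hz⟩ := mem_iUnion.1 hz
    exact mem_iUnion.2 ⟨i, mem_iUnion.2 ⟨t i, mem_iUnion.2 ⟨ht i, hz⟩⟩⟩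
  have hev := (up _ (rmono _ _ (hVm _) hWm hsub)).and
    ((hh (fun i => s i (t i))).and (eventually_ge_atTop I0))
  obtain ⟨i, h1, h2, h3⟩ := hev.exists
  exact htW i (h1 _ (ht i) ((h2 _ (ht i)).2 (hsh i _ h3 (ht i))))

lemma pfin_eventually {X Y : Set ℕ} (h : PFin.mk X = PFin.mk Y) :
    ∀ᶠ j in atTop, (j ∈ X ↔ j ∈ Y) := by
  have h1 : (symmDiff X Y).Finite := Quotient.exact (s := finSetoid ℕ) h
  have h2 := h1.compl_mem_cofinite
  rw [Nat.cofinite_eq_atTop] at h2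
  filter_upwards [h2] with j hj
  simp only [mem_compl_iff, Set.mem_symmDiff] at hj
  tauto

theorem oca_contra (oca : OCA) (μ : Measure CSp) (hμ : IsMeasureOK μ)
    (φ : MAlg μ → PFin ℕ) (hφ : IsEmbedding μ φ) : False := by
  classical
  have hrep : ∀ A : Set CSp, ∃ R : Set ℕ, ∀ h : MeasurableSet A, PFin.mk R = φ (MAlg.mk μ ⟨A, h⟩) := by
    intro A
    by_cases h : MeasurableSet A
    · obtain ⟨R, hR⟩ := Quotient.exists_rep (φ (MAlg.mk μ ⟨A, h⟩))
      exact ⟨R, fun _ => hR⟩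
    · exact ⟨∅, fun h' => absurd h' h⟩
  choose rep hrep using hrep
  refine finalContra oca μ hμ rep ?_ ?_ ?_
  · intro A B hA hB
    refine pfin_eventually (Y := rep A ∩ rep B) ?_
    rw [hrep _ (hA.inter hB)]
    have := hφ.map_inf (MAlg.mk μ ⟨A, hA⟩) (MAlg.mk μ ⟨B, hB⟩)
    rw [← hrep _ hA, ← hrep _ hB] at this
    exact this
  · intro A hA
    refine pfin_eventually (Y := (rep A)ᶜ) ?_
    rw [hrep _ hA.compl]
    have := hφ.map_compl (MAlg.mk μ ⟨A, hA⟩)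
    rw [← hrep _ hA] at this
    exact this
  · intro A hA hev
    have h1 : PFin.mk (rep A) = PFin.mk ∅ := by
      refine Quotient.sound (s := finSetoid ℕ) ?_
      show (symmDiff (rep A) ∅).Finite
      rw [← Nat.cofinite_eq_atTop, eventually_cofinite] at hev
      refine hev.subset ?_
      intro j hj
      simpa [Set.mem_symmDiff] using hj
    rw [hrep _ hA] at h1
    have h2 : φ (MAlg.mk μ ⟨A, hA⟩) = φ MAlg.bot := h1.trans hφ.map_bot.symm
    have h3 := hφ.injective h2
    have h4 : μ (symmDiff A ∅) = 0 := Quotient.exact (s := measSetoid μ) h3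
    have e : symmDiff A ∅ = A := by ext; simp [Set.mem_symmDiff]
    rwa [e] at h4

/-- OCA implies that every embedding `φ : ℳ → P(ℕ)/fin` has a lifting that is
exact and complete when restricted to the strata over some infinite `A ⊆ ℕ`. -/
theorem oca_gives_exact_complete_lifting (oca : OCA)
    (μ : Measure CSp) (hμ : IsMeasureOK μ)
    (φ : MAlg μ → PFin ℕ) (hφ : IsEmbedding μ φ) :
    ∃ (A : Set ℕ) (Φ : MAlg μ → Set ℕ), A.Infinite ∧ IsLifting φ Φ ∧
      (∀ n ∈ A, ∀ m ∈ A, n ≠ m → Disjoint (PhiPt Φ n []) (PhiPt Φ m [])) ∧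
      (∀ n ∈ A, ∀ s : List Bool,
        PhiPt Φ n s = PhiPt Φ n (s ++ [false]) ∪ PhiPt Φ n (s ++ [true]) ∧
        Disjoint (PhiPt Φ n (s ++ [false])) (PhiPt Φ n (s ++ [true]))) ∧
      (∀ f : ℕ → ℕ, ∀ O ⊆ BfA f A, AlmostEq (PhiSet Φ O) (PhiUnion Φ O)) := by
  exact (oca_contra oca μ hμ φ hφ).elim

end Paper
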